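/- Product rule in B^1_{∞,1} with div-curl structure: There exists an absolute constant C > 0 such that for vector fields u, v on 𝕋^d with div u = 0, ‖u·∇v‖_{B^1_{∞,1}} ≤ C (‖u‖_{B^0_{∞,1}} ‖v‖_{B^2_{∞,1}} + ‖u‖_{B^1_{∞,1}} ‖v‖_{B^1_{∞,1}}). -/

import Mathlib

open MeasureTheory Complex
open scoped BigOperators ENNReal NNReal

noncomputable section

/-! ## A Fourier-analytic framework for distributions on the torus `𝕋^d`

A distribution on `𝕋^d` is represented by its sequence of Fourier coefficients,
a function `(Fin d → ℤ) → E` (with `E = ℂ` for scalar functions, `E = Fin d → ℂ`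
for vector fields, etc.).  All operators (Littlewood–Paley blocks, Leray
projection, advection, Laplacian, ...) are defined on the Fourier side, and `L^p`
norms are computed from the realization as a (periodic) function on the cube. -/

/-- Euclidean norm of a lattice frequency. -/
def znorm {d : ℕ} (k : Fin d → ℤ) : ℝ := Real.sqrt (∑ i, ((k i : ℝ)) ^ 2)

/-- Squared Euclidean norm of a lattice frequency. -/
def znorm2 {d : ℕ} (k : Fin d → ℤ) : ℤ := ∑ i, (k i) ^ 2

/-- The character `e^{2πik·x}`. -/
def fChar {d : ℕ} (k : Fin d → ℤ) (x : Fin d → ℝ) : ℂ :=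
  Complex.exp (((2 * Real.pi * ∑ i, (k i : ℝ) * x i : ℝ) : ℂ) * Complex.I)

variable {d : ℕ} {E : Type*}

/-- Realization of a Fourier coefficient sequence as a (periodic) function on `ℝ^d`. -/
def realize [NormedAddCommGroup E] [NormedSpace ℂ E] (a : (Fin d → ℤ) → E) :
    (Fin d → ℝ) → E :=
  fun x => ∑' k, fChar k x • a k

/-- The fundamental cube of the torus, as a measure on `ℝ^d`. -/
def μT (d : ℕ) : Measure (Fin d → ℝ) := volume.restrict (Set.Icc 0 1)

/-- The `L^p` norm over the torus of (the realization of) a coefficient sequence. -/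
def tLp [NormedAddCommGroup E] [NormedSpace ℂ E] (p : ℝ≥0∞) (a : (Fin d → ℤ) → E) :
    ℝ≥0∞ :=
  eLpNorm (realize a) p (μT d)

/-- A smooth monotone Littlewood–Paley cutoff function `χ` as in the paper:
`χ : [0,∞) → [0,1]`, `χ ≡ 1` on `[0,1/2]`, `χ(3/4) = 1/2`, `χ ≡ 0` on `[1,∞)`. -/
structure Cutoff where
  χ : ℝ → ℝ
  smooth : ContDiff ℝ (⊤ : ℕ∞) χ
  mono : AntitoneOn χ (Set.Ici 0)
  nonneg : ∀ x, 0 ≤ χ x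
  le_one : ∀ x, χ x ≤ 1
  eq_one : ∀ x ∈ Set.Icc (0 : ℝ) (1 / 2), χ x = 1
  eq_half : χ (3 / 4) = 1 / 2
  eq_zero : ∀ x, (1 : ℝ) ≤ x → χ x = 0

/-- The symbol of the Littlewood–Paley block `Δ_j`:
`χ(t)` for `j = 0` and `φ(t/2^j) = χ(t/2^j) − χ(t/2^{j-1})` for `j ≥ 1`. -/
def lpSymb (c : Cutoff) : ℕ → ℝ → ℝ
  | 0, t => c.χ t
  | j + 1, t => c.χ (t / 2 ^ (j + 1)) - c.χ (t / 2 ^ j)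

/-- The Littlewood–Paley block `Δ_j`, acting on Fourier coefficients. -/
def blockC [NormedAddCommGroup E] [NormedSpace ℂ E] (c : Cutoff) (j : ℕ)
    (a : (Fin d → ℤ) → E) : (Fin d → ℤ) → E :=
  fun k => ((lpSymb c j (znorm k) : ℝ) : ℂ) • a k

/-- The low-frequency cutoff `S_j = Δ_0 + Δ_1 + ⋯ + Δ_j`, acting on Fourier coefficients. -/
def lowC [NormedAddCommGroup E] [NormedSpace ℂ E] (c : Cutoff) (j : ℕ)
    (a : (Fin d → ℤ) → E) : (Fin d → ℤ) → E :=
  fun k => ((∑ l ∈ Finset.range (j + 1), lpSymb c l (znorm k) : ℝ) : ℂ) • a k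

/-- The `ℓ^r` norm (`r ∈ [1,∞]`) of a sequence of extended nonnegative reals. -/
def lr (r : ℝ≥0∞) (a : ℕ → ℝ≥0∞) : ℝ≥0∞ :=
  if r = ∞ then ⨆ j, a j else (∑' j, a j ^ r.toReal) ^ (1 / r.toReal)

/-- The inhomogeneous Besov norm `‖·‖_{B^s_{p,r}}` on the torus:
the `ℓ^r` norm of `j ↦ 2^{js} ‖Δ_j a‖_{L^p}`. -/
def besov [NormedAddCommGroup E] [NormedSpace ℂ E] (c : Cutoff) (s : ℝ) (p r : ℝ≥0∞)
    (a : (Fin d → ℤ) → E) : ℝ≥0∞ :=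
  lr r fun j => (2 : ℝ≥0∞) ^ ((j : ℝ) * s) * tLp p (blockC c j a)

/-- Rapid decay of Fourier coefficients: the represented distribution is smooth. -/
def SmoothCoeff [NormedAddCommGroup E] (a : (Fin d → ℤ) → E) : Prop :=
  ∀ n : ℕ, ∃ C : ℝ, ∀ k, ‖a k‖ * (1 + znorm k) ^ n ≤ C

/-- The Fourier multiplier `Λ^s = (-Δ)^{s/2}` with symbol `|k|^s`. -/
def lambdaPow [NormedAddCommGroup E] [NormedSpace ℂ E] (s : ℝ) (a : (Fin d → ℤ) → E) :
    (Fin d → ℤ) → E :=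
  fun k => ((znorm k ^ s : ℝ) : ℂ) • a k

/-- Fourier coefficients of the pointwise product of a scalar function with
coefficients `a` and an `E`-valued function with coefficients `b` (convolution). -/
def convC [NormedAddCommGroup E] [NormedSpace ℂ E] (a : (Fin d → ℤ) → ℂ)
    (b : (Fin d → ℤ) → E) : (Fin d → ℤ) → E :=
  fun k => ∑' m, a m • b (k - m)

/-- The Bony paraproduct `T_u v = Σ_{j≥1} S_{j−1}u Δ_j v`, on Fourier coefficients. -/
def para (c : Cutoff) (u v : (Fin d → ℤ) → ℂ) : (Fin d → ℤ) → ℂ :=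
  fun k => ∑' j : ℕ, convC (lowC c j u) (blockC c (j + 1) v) k

/-- The Bony remainder `R(u,v) = Σ_{|j−l|≤1} Δ_j u Δ_l v`, on Fourier coefficients. -/
def remainder (c : Cutoff) (u v : (Fin d → ℤ) → ℂ) : (Fin d → ℤ) → ℂ :=
  fun k => ∑' j : ℕ, ∑' l : ℕ,
    if ((j : ℤ) - l).natAbs ≤ 1 then convC (blockC c j u) (blockC c l v) k else 0

/-- Fourier coefficients of a vector field on `𝕋^d`. -/
abbrev VC (d : ℕ) := (Fin d → ℤ) → Fin d → ℂ

/-- The divergence-free condition `∇·u = 0`, on Fourier coefficients. -/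
def DivFree {d : ℕ} (u : VC d) : Prop := ∀ k, ∑ i, (k i : ℂ) * u k i = 0

/-- Fourier coefficients of the advection term `u·∇v = Σ_l u_l ∂_l v`. -/
def advect {d : ℕ} (u v : VC d) : VC d :=
  fun k i => ∑' m : Fin d → ℤ,
    (∑ l, u m l * (((2 * Real.pi : ℝ) : ℂ) * Complex.I * ((k l - m l : ℤ) : ℂ)))
      * v (k - m) i

/-- The Leray projection `ℙ` onto divergence-free fields, on Fourier coefficients. -/
def leray {d : ℕ} (v : VC d) : VC d :=
  fun k i => if k = 0 then v k i
    else v k i - ((∑ l, (k l : ℂ) * v k l) / ((znorm2 k : ℤ) : ℂ)) * (k i : ℂ)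

/-- Fourier coefficients of the Laplacian `Δ`. -/
def lapC [NormedAddCommGroup E] [NormedSpace ℂ E] (a : (Fin d → ℤ) → E) :
    (Fin d → ℤ) → E :=
  fun k => ((-(4 * Real.pi ^ 2 * ((znorm2 k : ℤ) : ℝ)) : ℝ) : ℂ) • a k

/-- Fourier coefficients of the gradient `∇q` of a scalar function. -/
def gradC {d : ℕ} (q : (Fin d → ℤ) → ℂ) : VC d :=
  fun k i => ((2 * Real.pi : ℝ) : ℂ) * Complex.I * ((k i : ℤ) : ℂ) * q k

/-- Fourier coefficients of the full gradient `∇u` (a matrix field) of a vector field. -/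
def gradM {d : ℕ} (u : VC d) : (Fin d → ℤ) → Fin d → Fin d → ℂ :=
  fun k i l => ((2 * Real.pi : ℝ) : ℂ) * Complex.I * ((k l : ℤ) : ℂ) * u k i

/-- Fourier coefficients of the divergence `∇·w` of a vector field. -/
def divC {d : ℕ} (w : VC d) : (Fin d → ℤ) → ℂ :=
  fun k => ((2 * Real.pi : ℝ) : ℂ) * Complex.I * ∑ l, (k l : ℂ) * w k l

/-- The inverse `(−Δ)^{−1}` of the negative Laplacian on mean-zero functions. -/
def invNegLap [NormedAddCommGroup E] [NormedSpace ℂ E] (a : (Fin d → ℤ) → E) :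
    (Fin d → ℤ) → E :=
  fun k => if k = 0 then 0 else (((4 * Real.pi ^ 2 * ((znorm2 k : ℤ) : ℝ))⁻¹ : ℝ) : ℂ) • a k

/-- The commutator `I_j = [u·∇, ℙΔ_j] f = u·∇(ℙΔ_j f) − ℙΔ_j (u·∇ f)`. -/
def commJ {d : ℕ} (c : Cutoff) (u f : VC d) (j : ℕ) : VC d :=
  fun k i => advect u (leray (blockC c j f)) k i - leray (blockC c j (advect u f)) k i

/-- `U` (with pressure `P`) solves the incompressible Navier–Stokes equations
`∂_t u + u·∇u + ∇p = νΔu`, `∇·u = 0` on the time interval `[0,T]`, on the Fourier side. -/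
def SolvesNS (ν T : ℝ) (U : ℝ → VC 2) (P : ℝ → (Fin 2 → ℤ) → ℂ) : Prop :=
  (∀ t ∈ Set.Icc (0 : ℝ) T, DivFree (U t)) ∧
  ∀ t ∈ Set.Icc (0 : ℝ) T, ∀ k i,
    HasDerivAt (fun s => U s k i)
      ((ν : ℂ) * lapC (U t) k i - advect (U t) (U t) k i - gradC (P t) k i) t

/-- One step of the semi-implicit scheme
`(u^{n+1} − u^n)/τ + ℙ(u^n·∇u^{n+1}) = νΔu^{n+1}`. -/
def SchemeStep (ν τ : ℝ) (v w : VC 2) : Prop :=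
  ∀ k i, (w k i - v k i) / (τ : ℂ) + leray (advect v w) k i = (ν : ℂ) * lapC w k i

open scoped Classical in
/-- The Fourier truncation `Π_N`, keeping only the frequencies with `1 ≤ |k|_∞ ≤ N`. -/
def truncC {d : ℕ} (N : ℕ) (v : VC d) : VC d :=
  fun k i => if (∀ l, |k l| ≤ (N : ℤ)) ∧ k ≠ 0 then v k i else 0

/-- One step of the fully discrete Fourier spectral semi-implicit scheme
`(u^{n+1} − u^n)/τ + ℙΠ_N(u^n·∇u^{n+1}) = νΔu^{n+1}`. -/
def SchemeStepN (N : ℕ) (ν τ : ℝ) (v w : VC 2) : Prop :=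
  ∀ k i, (w k i - v k i) / (τ : ℂ) + leray (truncC N (advect v w)) k i
    = (ν : ℂ) * lapC w k i


/-- The supremum norm of the realization of a coefficient sequence. -/
def supN [NormedAddCommGroup E] [NormedSpace ℂ E] (a : (Fin d → ℤ) → E) : ℝ≥0∞ :=
  ⨆ x, ‖realize a x‖ₑ

section Trigonometric

variable [NormedAddCommGroup E] [NormedSpace ℂ E]

lemma realize_eq_sum {a : (Fin d → ℤ) → E} {S : Finset (Fin d → ℤ)}
    (hS : ∀ k ∉ S, a k = 0) (x : Fin d → ℝ) :
    realize a x = ∑ k ∈ S, fChar k x • a k :=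
  tsum_eq_sum fun k hk => by rw [hS k hk, smul_zero]

lemma continuous_fChar (k : Fin d → ℤ) : Continuous (fChar k) := by
  unfold fChar
  fun_prop

lemma fChar_add_left (k l : Fin d → ℤ) (x : Fin d → ℝ) :
    fChar (k + l) x = fChar k x * fChar l x := by
  simp only [fChar, ← Complex.exp_add, Pi.add_apply]
  congr 1
  push_cast
  simp only [add_mul, Finset.sum_add_distrib]
  ring

lemma fChar_add_right (k : Fin d → ℤ) (x y : Fin d → ℝ) :
    fChar k (x + y) = fChar k x * fChar k y := by
  simp only [fChar, ← Complex.exp_add, Pi.add_apply]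
  congr 1
  push_cast
  simp only [mul_add, Finset.sum_add_distrib]
  ring

lemma fChar_int (k n : Fin d → ℤ) : fChar k (fun i => (n i : ℝ)) = 1 := by
  rw [fChar, Complex.exp_eq_one_iff]
  exact ⟨∑ i, k i * n i, by push_cast; ring⟩

lemma realize_add_int (a : (Fin d → ℤ) → E) (x : Fin d → ℝ) (n : Fin d → ℤ) :
    realize a (x + fun i => (n i : ℝ)) = realize a x := by
  simp only [realize, fChar_add_right, fChar_int, mul_one]

lemma continuous_realize {a : (Fin d → ℤ) → E} (ha : (Function.support a).Finite) :
    Continuous (realize a) := by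
  have h : realize a = fun x => ∑ k ∈ ha.toFinset, fChar k x • a k :=
    funext fun x => realize_eq_sum (by simp) x
  rw [h]
  exact continuous_finsetSum _ fun k _ => (continuous_fChar k).smul continuous_const

lemma enorm_realize_le_supN (a : (Fin d → ℤ) → E) (x : Fin d → ℝ) :
    ‖realize a x‖ₑ ≤ supN a :=
  le_iSup (fun x => ‖realize a x‖ₑ) x

lemma tLp_top_le_supN (a : (Fin d → ℤ) → E) : tLp ∞ a ≤ supN a := by
  rw [tLp, eLpNorm_exponent_top]
  exact eLpNormEssSup_le_of_ae_enorm_bound (.of_forall (enorm_realize_le_supN a))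

lemma supN_le_tLp_top {a : (Fin d → ℤ) → E} (ha : (Function.support a).Finite) :
    supN a ≤ tLp ∞ a := by
  refine iSup_le fun x => ?_
  by_contra! hx
  have hper : realize a (fun i => Int.fract (x i)) = realize a x := by
    rw [← realize_add_int a _ (fun i => ⌊x i⌋)]
    congr 1
    ext i
    exact Int.fract_add_floor (x i)
  rw [← hper] at hx
  have hopen : IsOpen {y | tLp ∞ a < ‖realize a y‖ₑ} :=
    isOpen_lt continuous_const (continuous_realize ha).enorm
  have hmem : (fun i => Int.fract (x i)) ∈
      closure (Set.univ.pi fun _ : Fin d => Set.Ioo (0 : ℝ) 1) := by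
    rw [closure_pi_set]
    intro i _
    rw [closure_Ioo zero_ne_one]
    exact ⟨Int.fract_nonneg _, (Int.fract_lt_one _).le⟩
  obtain ⟨y, hy⟩ := mem_closure_iff.1 hmem _ hopen hx
  have hpos := (hopen.inter (isOpen_set_pi Set.finite_univ fun _ _ => isOpen_Ioo)).measure_pos
    volume ⟨y, hy⟩
  have hae : ∀ᵐ z ∂μT d, ‖realize a z‖ₑ ≤ tLp ∞ a := by
    rw [tLp, eLpNorm_exponent_top]
    exact enorm_ae_le_eLpNormEssSup _ _
  rw [μT, ae_restrict_iff' measurableSet_Icc, ae_iff] at hae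
  refine hpos.ne' (measure_mono_null (fun z hz => ?_) hae)
  simp only [Set.mem_ofPred_eq, Classical.not_imp, not_le]
  exact ⟨⟨fun i => (hz.2 i trivial).1.le, fun i => (hz.2 i trivial).2.le⟩, hz.1⟩

lemma tLp_top_eq_supN {a : (Fin d → ℤ) → E} (ha : (Function.support a).Finite) :
    tLp ∞ a = supN a :=
  (tLp_top_le_supN a).antisymm (supN_le_tLp_top ha)

open FourierTransform in
/-- A Fourier multiplier with Schwartz symbol is bounded in the supremum norm, uniformly under
dilation of the symbol. -/
lemma exists_supN_multiplier_le [CompleteSpace E]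
    (Φ : SchwartzMap (EuclideanSpace ℝ (Fin d)) ℂ) :
    ∃ C : ℝ≥0, ∀ (N : ℝ) (a : (Fin d → ℤ) → E), (Function.support a).Finite →
      supN (fun k => Φ (WithLp.toLp 2 fun i => (k i : ℝ) / N) • a k) ≤ C * supN a := by
  have hfin : ∫⁻ y, ‖(𝓕 Φ) y‖ₑ ≠ ∞ := (𝓕 Φ).integrable.2.ne
  refine ⟨(∫⁻ y, ‖(𝓕 Φ) y‖ₑ).toNNReal, fun N a ha => iSup_le fun x => ?_⟩
  rw [ENNReal.coe_toNNReal hfin]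
  have hinv : ∀ k : Fin d → ℤ, Φ (WithLp.toLp 2 fun i => (k i : ℝ) / N)
      = ∫ y, (𝓕 Φ) y * fChar k (fun i => y i / N) := by
    intro k
    conv_lhs => rw [← FourierPair.fourierInv_fourier_eq
      (F := SchwartzMap (EuclideanSpace ℝ (Fin d)) ℂ) Φ]
    rw [SchwartzMap.fourierInv_coe, Real.fourierInv_eq']
    congr 1
    ext y
    rw [smul_eq_mul, mul_comm, fChar]
    congr 4
    simp only [PiLp.inner_apply, mul_assoc]
    congr 2
    refine Finset.sum_congr rfl fun i _ => ?_
    simp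
    ring
  have hint : ∀ k : Fin d → ℤ, Integrable fun y : EuclideanSpace ℝ (Fin d) =>
      (𝓕 Φ) y * fChar k (fun i => y i / N) := by
    intro k
    refine (𝓕 Φ).integrable.mul_bdd (c := 1) ?_ (.of_forall fun y => ?_)
    · refine Continuous.aestronglyMeasurable ((continuous_fChar k).comp ?_)
      fun_prop
    · rw [fChar, Complex.norm_exp_ofReal_mul_I]
  have key : realize (fun k => Φ (WithLp.toLp 2 fun i => (k i : ℝ) / N) • a k) x
      = ∫ y : EuclideanSpace ℝ (Fin d), (𝓕 Φ) y • realize a (x + fun i => y i / N) := by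
    rw [realize_eq_sum (S := ha.toFinset) (fun k hk => by simp_all)]
    simp only [fun y => realize_eq_sum (a := a) (S := ha.toFinset) (by simp) y, Finset.smul_sum]
    rw [integral_finsetSum]
    · refine Finset.sum_congr rfl fun k _ => ?_
      rw [hinv, ← integral_smul_const, ← integral_smul]
      congr 1
      ext y
      simp only [fChar_add_right, smul_smul]
      congr 1
      ring
    · intro k _
      refine (((hint k).smul_const (a k)).smul (fChar k x)).congr (.of_forall fun y => ?_)
      simp only [fChar_add_right, smul_smul, Pi.smul_apply]
      congr 1
      ring
  rw [key, ← lintegral_mul_const _ (𝓕 Φ).continuous.enorm.measurable]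
  refine (enorm_integral_le_lintegral_enorm _).trans (lintegral_mono fun y => ?_)
  rw [enorm_smul]
  gcongr
  exact enorm_realize_le_supN a _

end Trigonometric

section Parseval

/-- The probability Haar measure on `ℝ / ℤ`, with respect to which Mathlib states the orthonormality
of the multivariate Fourier monomials. -/
local instance : MeasureSpace UnitAddCircle := ⟨AddCircle.haarAddCircle⟩

local instance : IsProbabilityMeasure (volume : Measure UnitAddCircle) :=
  inferInstanceAs (IsProbabilityMeasure AddCircle.haarAddCircle)

lemma mFourier_coe_eq_fChar (k : Fin d → ℤ) (x : Fin d → ℝ) :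
    UnitAddTorus.mFourier k (fun i => (x i : UnitAddCircle)) = fChar k x := by
  simp only [UnitAddTorus.mFourier, ContinuousMap.coe_mk, fourier_coe_apply, fChar,
    ← Complex.exp_sum]
  congr 1
  push_cast
  rw [Finset.mul_sum, Finset.sum_mul]
  refine Finset.sum_congr rfl fun i _ => ?_
  ring

/-- Parseval's inequality for trigonometric polynomials bounded by `M`. -/
lemma sum_norm_sq_le_of_norm_realize_le {a : (Fin d → ℤ) → ℂ} (ha : (Function.support a).Finite)
    {M : ℝ} (hM : ∀ x, ‖realize a x‖ ≤ M) (S : Finset (Fin d → ℤ)) :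
    ∑ k ∈ S, ‖a k‖ ^ 2 ≤ M ^ 2 := by
  have hM0 : 0 ≤ M := (norm_nonneg _).trans (hM 0)
  let f : C(UnitAddTorus (Fin d), ℂ) := ∑ k ∈ ha.toFinset, a k • UnitAddTorus.mFourier k
  have hf : ‖f‖ ≤ M := by
    refine (ContinuousMap.norm_le _ hM0).2 fun z => ?_
    choose x hx using fun i => QuotientAddGroup.mk_surjective (z i)
    have hz : z = fun i => (x i : UnitAddCircle) := funext fun i => (hx i).symm
    refine le_trans (le_of_eq (congrArg norm ?_)) (hM x)
    rw [realize_eq_sum (S := ha.toFinset) (by simp), hz]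
    simp only [f, ContinuousMap.coe_sum, Finset.sum_apply, ContinuousMap.coe_smul, Pi.smul_apply,
      mFourier_coe_eq_fChar, smul_eq_mul, mul_comm]
  let F : Lp ℂ 2 (volume : Measure (UnitAddTorus (Fin d))) := ContinuousMap.toLp 2 volume ℂ f
  have hF : ‖F‖ ≤ M := by
    refine ((ContinuousMap.toLp (E := ℂ) 2 volume ℂ).le_opNorm f).trans ?_
    have h1 := ContinuousMap.toLp_norm_le (E := ℂ) (p := 2) (𝕜 := ℂ)
      (μ := (volume : Measure (UnitAddTorus (Fin d))))
    have h2 : measureUnivNNReal (volume : Measure (UnitAddTorus (Fin d))) = 1 := by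
      simp [measureUnivNNReal]
    rw [h2] at h1
    simp only [NNReal.coe_one, Real.one_rpow] at h1
    nlinarith [norm_nonneg f]
  have hFsum : F = ∑ k ∈ ha.toFinset, a k • UnitAddTorus.mFourierLp 2 k := by
    simp [F, f, UnitAddTorus.mFourierLp]
  have hcoef : ∀ k, inner ℂ (UnitAddTorus.mFourierLp 2 k) F = a k := by
    intro k
    rw [hFsum]
    by_cases hk : k ∈ ha.toFinset
    · exact UnitAddTorus.orthonormal_mFourier.inner_right_sum a hk
    · have : a k = 0 := by simpa using hk
      rw [this, inner_sum]
      refine Finset.sum_eq_zero fun l hl => ?_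
      rw [inner_smul_right, UnitAddTorus.orthonormal_mFourier.2 (fun h : k = l => hk (h ▸ hl)),
        mul_zero]
  calc ∑ k ∈ S, ‖a k‖ ^ 2
      = ∑ k ∈ S, ‖inner ℂ (UnitAddTorus.mFourierLp 2 k) F‖ ^ 2 := by simp only [hcoef]
    _ ≤ ‖F‖ ^ 2 := UnitAddTorus.orthonormal_mFourier.sum_inner_products_le F
    _ ≤ M ^ 2 := by gcongr

end Parseval

section Blocks

lemma znorm_eq_norm (k : Fin d → ℤ) :
    znorm k = ‖(WithLp.toLp 2 fun i => (k i : ℝ) : EuclideanSpace ℝ (Fin d))‖ := by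
  simp [znorm, EuclideanSpace.norm_eq]

lemma znorm_nonneg (k : Fin d → ℤ) : 0 ≤ znorm k := Real.sqrt_nonneg _

lemma znorm_add_le (k l : Fin d → ℤ) : znorm (k + l) ≤ znorm k + znorm l := by
  simp only [znorm_eq_norm]
  refine le_trans (le_of_eq ?_) (norm_add_le _ _)
  congr 1
  ext i
  simp

lemma norm_toLp_div (k : Fin d → ℤ) {N : ℝ} (hN : 0 < N) :
    ‖(WithLp.toLp 2 fun i => (k i : ℝ) / N : EuclideanSpace ℝ (Fin d))‖ = znorm k / N := by
  have h : (WithLp.toLp 2 fun i => (k i : ℝ) / N : EuclideanSpace ℝ (Fin d))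
      = N⁻¹ • WithLp.toLp 2 fun i => (k i : ℝ) := by
    ext i
    simp [div_eq_inv_mul]
  rw [h, norm_smul, znorm_eq_norm, norm_inv, Real.norm_of_nonneg hN.le, div_eq_inv_mul]

lemma finite_znorm_lt (R : ℝ) : {k : Fin d → ℤ | znorm k < R}.Finite := by
  refine (Set.finite_Icc (fun _ => -⌈R⌉) (fun _ : Fin d => ⌈R⌉)).subset fun k hk => ?_
  have h : ∀ i, |(k i : ℝ)| ≤ ⌈R⌉ := by
    intro i
    refine le_trans ?_ (hk.le.trans (Int.le_ceil R))
    rw [znorm_eq_norm]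
    exact PiLp.norm_apply_le (WithLp.toLp 2 fun i => (k i : ℝ) : EuclideanSpace ℝ (Fin d)) i
  exact ⟨fun i => by exact_mod_cast (abs_le.1 (h i)).1,
    fun i => by exact_mod_cast (abs_le.1 (h i)).2⟩

lemma contDiff_cutoff_norm (c : Cutoff) {F : Type*} [NormedAddCommGroup F]
    [InnerProductSpace ℝ F] : ContDiff ℝ (⊤ : ℕ∞) fun ξ : F => c.χ ‖ξ‖ := by
  rw [contDiff_iff_contDiffAt]
  intro ξ
  by_cases hξ : ξ = 0
  · refine (contDiffAt_const (c := (1 : ℝ))).congr_of_eventuallyEq ?_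
    filter_upwards [Metric.ball_mem_nhds ξ (by norm_num : (0 : ℝ) < 1 / 2)] with η hη
    rw [hξ, mem_ball_zero_iff] at hη
    exact c.eq_one _ ⟨norm_nonneg _, hη.le⟩
  · exact c.smooth.contDiffAt.comp ξ (contDiffAt_norm ℝ hξ)

lemma hasCompactSupport_cutoff_norm (c : Cutoff) {F : Type*} [NormedAddCommGroup F]
    [ProperSpace F] : HasCompactSupport fun ξ : F => c.χ ‖ξ‖ :=
  HasCompactSupport.intro (isCompact_closedBall (0 : F) 1) fun ξ hξ => by
    rw [mem_closedBall_zero_iff, not_le] at hξ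
    exact c.eq_zero _ hξ.le

/-- The radial Schwartz function `ξ ↦ χ(|ξ|)`. -/
def cutoffSchwartz (c : Cutoff) (d : ℕ) : SchwartzMap (EuclideanSpace ℝ (Fin d)) ℂ :=
  HasCompactSupport.toSchwartzMap (f := fun ξ => ((c.χ ‖ξ‖ : ℝ) : ℂ))
    ((hasCompactSupport_cutoff_norm c).comp_left Complex.ofReal_zero)
    (Complex.ofRealCLM.contDiff.comp (contDiff_cutoff_norm c))

/-- The Schwartz function `ξ ↦ 2πi ξ_l χ(|ξ|/2)`. -/
def derivCutoffSchwartz (c : Cutoff) (d : ℕ) (l : Fin d) :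
    SchwartzMap (EuclideanSpace ℝ (Fin d)) ℂ :=
  HasCompactSupport.toSchwartzMap
    (f := fun ξ => (((2 * Real.pi : ℝ) : ℂ) * Complex.I * (ξ l : ℝ)) *
      ((c.χ ‖(2⁻¹ : ℝ) • ξ‖ : ℝ) : ℂ))
    (((hasCompactSupport_cutoff_norm c).comp_smul (by norm_num)).comp_left
      Complex.ofReal_zero).mul_left
    ((contDiff_const.mul (Complex.ofRealCLM.contDiff.comp
      (EuclideanSpace.proj (𝕜 := ℝ) l).contDiff)).mul
      (Complex.ofRealCLM.contDiff.comp ((contDiff_cutoff_norm c).comp (contDiff_const_smul _))))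

lemma cutoffSchwartz_apply (c : Cutoff) (ξ : EuclideanSpace ℝ (Fin d)) :
    cutoffSchwartz c d ξ = ((c.χ ‖ξ‖ : ℝ) : ℂ) := rfl

lemma derivCutoffSchwartz_apply (c : Cutoff) (l : Fin d) (ξ : EuclideanSpace ℝ (Fin d)) :
    derivCutoffSchwartz c d l ξ = (((2 * Real.pi : ℝ) : ℂ) * Complex.I * (ξ l : ℝ)) *
      ((c.χ ‖(2⁻¹ : ℝ) • ξ‖ : ℝ) : ℂ) := rfl

lemma lpSymb_eq_zero_of_le (c : Cutoff) {j : ℕ} {t : ℝ} (ht : 2 ^ j ≤ t) : lpSymb c j t = 0 := by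
  cases j with
  | zero => exact c.eq_zero _ (by simpa using ht)
  | succ j =>
    have h1 : (1 : ℝ) ≤ t / 2 ^ (j + 1) := by rwa [le_div_iff₀ (by positivity), one_mul]
    have h2 : (1 : ℝ) ≤ t / 2 ^ j := by
      rw [le_div_iff₀ (by positivity), one_mul]
      rw [pow_succ] at ht
      have : (0 : ℝ) < 2 ^ j := by positivity
      linarith
    rw [lpSymb, c.eq_zero _ h1, c.eq_zero _ h2, sub_zero]

lemma lpSymb_succ_eq_zero_of_le (c : Cutoff) {j : ℕ} {t : ℝ} (h0 : 0 ≤ t)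
    (ht : 2 * t ≤ 2 ^ j) : lpSymb c (j + 1) t = 0 := by
  have h1 : t / 2 ^ j ≤ 1 / 2 := by
    rw [div_le_iff₀ (by positivity)]
    linarith
  have h2 : t / 2 ^ (j + 1) ≤ 1 / 2 := by
    refine le_trans ?_ h1
    gcongr <;> norm_num
  rw [lpSymb, c.eq_one _ ⟨by positivity, h1⟩, c.eq_one _ ⟨by positivity, h2⟩, sub_self]

lemma sum_lpSymb (c : Cutoff) (n : ℕ) (t : ℝ) :
    ∑ j ∈ Finset.range (n + 1), lpSymb c j t = c.χ (t / 2 ^ n) := by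
  induction n with
  | zero => simp [lpSymb]
  | succ n ih => rw [Finset.sum_range_succ, ih, lpSymb]; ring

lemma hasSum_lpSymb (c : Cutoff) {t : ℝ} (h0 : 0 ≤ t) : HasSum (fun j => lpSymb c j t) 1 := by
  obtain ⟨n, hn⟩ := pow_unbounded_of_one_lt (2 * t) (one_lt_two : (1 : ℝ) < 2)
  have h : ∑ j ∈ Finset.range (n + 1), lpSymb c j t = 1 := by
    rw [sum_lpSymb]
    refine c.eq_one _ ⟨by positivity, ?_⟩
    rw [div_le_iff₀ (by positivity)]
    linarith
  rw [← h]
  refine hasSum_sum_of_ne_finset_zero fun j hj => ?_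
  obtain ⟨m, rfl⟩ : ∃ m, j = m + 1 := ⟨j - 1, by simp at hj; omega⟩
  refine lpSymb_succ_eq_zero_of_le c h0 (hn.le.trans ?_)
  have : n ≤ m := by simp at hj; omega
  gcongr
  norm_num

variable [NormedAddCommGroup E] [NormedSpace ℂ E]

lemma blockC_eq_zero_of_le (c : Cutoff) {j : ℕ} (a : (Fin d → ℤ) → E) {k : Fin d → ℤ}
    (hk : 2 ^ j ≤ znorm k) : blockC c j a k = 0 := by
  rw [blockC, lpSymb_eq_zero_of_le c hk, Complex.ofReal_zero, zero_smul]

lemma finite_support_blockC (c : Cutoff) (j : ℕ) (a : (Fin d → ℤ) → E) :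
    (Function.support (blockC c j a)).Finite :=
  (finite_znorm_lt (2 ^ j)).subset fun k hk => by
    by_contra h
    exact hk (blockC_eq_zero_of_le c a (not_lt.1 h))

lemma supN_sub_le {a b : (Fin d → ℤ) → E} (ha : (Function.support a).Finite)
    (hb : (Function.support b).Finite) : supN (fun k => a k - b k) ≤ supN a + supN b := by
  refine iSup_le fun x => ?_
  have h : realize (fun k => a k - b k) x = realize a x - realize b x := by
    classical
    rw [realize_eq_sum (a := a) (S := ha.toFinset ∪ hb.toFinset) (by simp +contextual),
      realize_eq_sum (a := b) (S := ha.toFinset ∪ hb.toFinset) (by simp +contextual),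
      realize_eq_sum (S := ha.toFinset ∪ hb.toFinset) (by simp +contextual),
      ← Finset.sum_sub_distrib]
    simp only [smul_sub]
  rw [h]
  exact enorm_sub_le.trans (add_le_add (enorm_realize_le_supN a x) (enorm_realize_le_supN b x))

/-- The Littlewood–Paley blocks are bounded in the supremum norm, uniformly in `j`. -/
lemma exists_supN_blockC_le [CompleteSpace E] (c : Cutoff) :
    ∃ C : ℝ≥0, ∀ (j : ℕ) (a : (Fin d → ℤ) → E), (Function.support a).Finite →
      supN (blockC c j a) ≤ C * supN a := by
  obtain ⟨C, hC⟩ := exists_supN_multiplier_le (E := E) (cutoffSchwartz c d)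
  refine ⟨C + C, fun j a ha => ?_⟩
  have hdil : ∀ j : ℕ, supN (fun k => ((c.χ (znorm k / 2 ^ j) : ℝ) : ℂ) • a k) ≤ C * supN a := by
    intro j
    have h := hC (2 ^ j) a ha
    simp only [cutoffSchwartz_apply, norm_toLp_div _ (pow_pos two_pos j)] at h
    exact h
  have hsupp : ∀ j : ℕ,
      (Function.support fun k => ((c.χ (znorm k / 2 ^ j) : ℝ) : ℂ) • a k).Finite :=
    fun j => ha.subset (Function.support_smul_subset_right _ _)
  rw [ENNReal.coe_add, add_mul]
  cases j with
  | zero =>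
    refine le_trans (le_of_eq ?_) ((hdil 0).trans le_self_add)
    simp only [pow_zero, div_one]
    rfl
  | succ j =>
    refine le_trans (le_of_eq ?_)
      ((supN_sub_le (hsupp (j + 1)) (hsupp j)).trans (add_le_add (hdil (j + 1)) (hdil j)))
    congr 1
    ext k
    simp only [blockC, lpSymb, Complex.ofReal_sub, sub_smul]

/-- Fourier coefficients of the partial derivative `∂_l`. -/
def partialC (l : Fin d) (a : (Fin d → ℤ) → E) : (Fin d → ℤ) → E :=
  fun k => (((2 * Real.pi : ℝ) : ℂ) * Complex.I * ((k l : ℤ) : ℂ)) • a k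

/-- Bernstein's inequality for a partial derivative of a Littlewood–Paley block. -/
lemma exists_supN_partialC_blockC_le [CompleteSpace E] (c : Cutoff) :
    ∃ C : ℝ≥0, ∀ (l : Fin d) (j : ℕ) (a : (Fin d → ℤ) → E),
      supN (partialC l (blockC c j a)) ≤ C * 2 ^ j * supN (blockC c j a) := by
  choose C hC using fun l => exists_supN_multiplier_le (E := E) (derivCutoffSchwartz c d l)
  refine ⟨∑ l, C l, fun l j a => ?_⟩
  have h := hC l (2 ^ j) (fun k => ((2 : ℂ) ^ j) • blockC c j a k)
    ((finite_support_blockC c j a).subset (Function.support_const_smul_subset _ _))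
  have hl : (fun k : Fin d → ℤ => derivCutoffSchwartz c d l
      (WithLp.toLp 2 fun i => (k i : ℝ) / 2 ^ j) • ((2 : ℂ) ^ j) • blockC c j a k)
      = partialC l (blockC c j a) := by
    ext k
    by_cases hk : 2 ^ j ≤ znorm k
    · simp [partialC, blockC_eq_zero_of_le c a hk]
    · have h1 : c.χ ‖(2⁻¹ : ℝ) • (WithLp.toLp 2 fun i => (k i : ℝ) / 2 ^ j :
          EuclideanSpace ℝ (Fin d))‖ = 1 := by
        refine c.eq_one _ ⟨norm_nonneg _, ?_⟩
        rw [norm_smul, norm_toLp_div _ (pow_pos two_pos j)]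
        have : znorm k / 2 ^ j ≤ 1 := by
          rw [div_le_one (by positivity)]
          exact (not_le.1 hk).le
        norm_num
        linarith
      rw [derivCutoffSchwartz_apply, h1, smul_smul, partialC]
      congr 1
      push_cast
      field_simp
  have hr : supN (fun k => ((2 : ℂ) ^ j) • blockC c j a k) ≤ 2 ^ j * supN (blockC c j a) := by
    refine iSup_le fun x => ?_
    have : realize (fun k => ((2 : ℂ) ^ j) • blockC c j a k) x
        = ((2 : ℂ) ^ j) • realize (blockC c j a) x := by
      rw [realize_eq_sum (a := blockC c j a) (S := (finite_support_blockC c j a).toFinset) (by simp),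
        realize_eq_sum (S := (finite_support_blockC c j a).toFinset)
          (fun k hk => by rw [show blockC c j a k = 0 by simpa using hk, smul_zero]),
        Finset.smul_sum]
      exact Finset.sum_congr rfl fun k _ => smul_comm _ _ _
    rw [this, enorm_smul]
    gcongr
    · simp [← ofReal_norm]
    · exact enorm_realize_le_supN _ x
  rw [hl] at h
  calc _ ≤ _ := h
    _ ≤ (C l : ℝ≥0∞) * (2 ^ j * supN (blockC c j a)) := by gcongr
    _ = C l * 2 ^ j * supN (blockC c j a) := (mul_assoc _ _ _).symm
    _ ≤ _ := by
      gcongr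
      exact Finset.single_le_sum (f := C) (fun _ _ => zero_le) (Finset.mem_univ l)

end Blocks

section Advection

lemma enorm_pi_le {z : Fin d → ℂ} {M : ℝ≥0∞} (h : ∀ i, ‖z i‖ₑ ≤ M) : ‖z‖ₑ ≤ M := by
  by_cases hM : M = ∞
  · exact hM ▸ le_top
  lift M to ℝ≥0 using hM
  simp only [enorm_le_coe] at h ⊢
  exact (pi_nnnorm_le_iff).2 h

lemma enorm_apply_le (z : Fin d → ℂ) (i : Fin d) : ‖z i‖ₑ ≤ ‖z‖ₑ := by
  simpa only [enorm_eq_nnnorm, ENNReal.coe_le_coe] using nnnorm_le_pi_nnnorm z i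

lemma supN_ne_top [NormedAddCommGroup E] [NormedSpace ℂ E] {a : (Fin d → ℤ) → E}
    (ha : (Function.support a).Finite) : supN a ≠ ∞ := by
  refine ne_top_of_le_ne_top (b := ∑ k ∈ ha.toFinset, ‖a k‖ₑ)
    (ENNReal.sum_ne_top.2 fun _ _ => enorm_ne_top) (iSup_le fun x => ?_)
  rw [realize_eq_sum (S := ha.toFinset) (by simp)]
  refine (enorm_sum_le _ _).trans (Finset.sum_le_sum fun k _ => ?_)
  have : ‖fChar k x‖ₑ = 1 := by
    rw [← ofReal_norm, fChar, Complex.norm_exp_ofReal_mul_I, ENNReal.ofReal_one]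
  rw [enorm_smul, this, one_mul]

lemma finite_support_apply {a : VC d} (ha : (Function.support a).Finite) (i : Fin d) :
    (Function.support fun k => a k i).Finite :=
  ha.subset fun k hk h => hk (by simp [h])

lemma realize_apply {a : VC d} (ha : (Function.support a).Finite) (i : Fin d) (x : Fin d → ℝ) :
    realize (fun k => a k i) x = realize a x i := by
  rw [realize_eq_sum (a := a) (S := ha.toFinset) (by simp),
    realize_eq_sum (S := ha.toFinset) (fun k hk => by rw [show a k = 0 by simpa using hk]; rfl)]
  simp

lemma supN_apply_le {a : VC d} (ha : (Function.support a).Finite) (i : Fin d) :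
    supN (fun k => a k i) ≤ supN a :=
  iSup_le fun x => by
    rw [realize_apply ha]
    exact (enorm_apply_le _ i).trans (enorm_realize_le_supN a x)

/-- By the Cauchy–Schwarz and Parseval inequalities, the convolution of the coefficients of two
trigonometric polynomials is controlled by the product of their supremum norms. -/
lemma tsum_enorm_conv_le {a b : (Fin d → ℤ) → ℂ} (ha : (Function.support a).Finite)
    (hb : (Function.support b).Finite) (k : Fin d → ℤ) :
    ∑' m, ‖a m * b (k - m)‖ₑ ≤ supN a * supN b := by
  have hsq : ∀ {f : (Fin d → ℤ) → ℂ}, (Function.support f).Finite → ∀ S : Finset (Fin d → ℤ),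
      √(∑ m ∈ S, ‖f m‖ ^ 2) ≤ (supN f).toReal := by
    intro f hf S
    refine Real.sqrt_le_iff.2 ⟨ENNReal.toReal_nonneg,
      sum_norm_sq_le_of_norm_realize_le hf (fun x => ?_) S⟩
    rw [← toReal_enorm]
    exact ENNReal.toReal_mono (supN_ne_top hf) (enorm_realize_le_supN f x)
  rw [ENNReal.tsum_eq_iSup_sum]
  refine iSup_le fun S => ?_
  have hS : ∑ m ∈ S, ‖b (k - m)‖ ^ 2 = ∑ m ∈ S.map (Equiv.subLeft k).toEmbedding, ‖b m‖ ^ 2 := by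
    rw [Finset.sum_map]
    rfl
  calc ∑ m ∈ S, ‖a m * b (k - m)‖ₑ
      = ENNReal.ofReal (∑ m ∈ S, ‖a m‖ * ‖b (k - m)‖) := by
        rw [ENNReal.ofReal_sum_of_nonneg fun _ _ => by positivity]
        simp only [← norm_mul, ofReal_norm]
    _ ≤ ENNReal.ofReal ((supN a).toReal * (supN b).toReal) := by
        refine ENNReal.ofReal_le_ofReal ((Real.sum_mul_le_sqrt_mul_sqrt _ _ _).trans ?_)
        rw [hS]
        exact mul_le_mul (hsq ha S) (hsq hb _) (Real.sqrt_nonneg _) ENNReal.toReal_nonneg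
    _ = supN a * supN b := by
        rw [ENNReal.ofReal_mul ENNReal.toReal_nonneg, ENNReal.ofReal_toReal (supN_ne_top ha),
          ENNReal.ofReal_toReal (supN_ne_top hb)]

lemma finite_support_partialC {b : VC d} (hb : (Function.support b).Finite) (l : Fin d) :
    (Function.support (partialC l b)).Finite :=
  hb.subset fun k hk h => hk (by simp [partialC, h])

lemma advect_summand (u v : VC d) (k m : Fin d → ℤ) (i : Fin d) :
    (∑ l, u m l * (((2 * Real.pi : ℝ) : ℂ) * Complex.I * ((k l - m l : ℤ) : ℂ))) * v (k - m) i
      = ∑ l, u m l * partialC l v (k - m) i := by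
  rw [Finset.sum_mul]
  refine Finset.sum_congr rfl fun l _ => ?_
  simp only [partialC, Pi.smul_apply, Pi.sub_apply, smul_eq_mul]
  ring

lemma advect_apply (u v : VC d) (k : Fin d → ℤ) (i : Fin d) :
    advect u v k i = ∑' m, ∑ l, u m l * partialC l v (k - m) i := by
  simp only [advect, advect_summand]

lemma exists_ne_zero_of_advect_ne_zero {a b : VC d} {k : Fin d → ℤ} (h : advect a b k ≠ 0) :
    ∃ m, a m ≠ 0 ∧ b (k - m) ≠ 0 := by
  by_contra! h'
  refine h (funext fun i => ?_)
  rw [advect_apply]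
  refine (tsum_congr fun m => ?_).trans tsum_zero
  by_cases hm : a m = 0
  · simp [hm]
  · simp [partialC, h' m hm]

lemma finite_support_advect {a b : VC d} (ha : (Function.support a).Finite)
    (hb : (Function.support b).Finite) : (Function.support (advect a b)).Finite :=
  (ha.add hb).subset fun k hk => by
    obtain ⟨m, hm, hkm⟩ := exists_ne_zero_of_advect_ne_zero hk
    exact ⟨m, hm, k - m, hkm, by simp⟩

lemma realize_advect {a b : VC d} (ha : (Function.support a).Finite)
    (hb : (Function.support b).Finite) (x : Fin d → ℝ) (i : Fin d) :
    realize (advect a b) x i = ∑ l, realize a x l * realize (partialC l b) x i := by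
  have hs : ∀ m ∈ ha.toFinset, Summable fun k : Fin d → ℤ =>
      fChar k x * ∑ l, a m l * partialC l b (k - m) i := by
    intro m _
    refine summable_of_hasFiniteSupport ((hb.image (m + ·)).subset fun k hk => ?_)
    refine ⟨k - m, fun h => hk ?_, by simp⟩
    simp [partialC, h]
  have hshift : ∀ m, ∑' k : Fin d → ℤ, fChar k x * ∑ l, a m l * partialC l b (k - m) i
      = ∑ l, fChar m x * a m l * realize (partialC l b) x i := by
    intro m
    rw [← (Equiv.addLeft m).tsum_eq]
    simp only [Equiv.coe_addLeft, add_sub_cancel_left, fChar_add_left, Finset.mul_sum]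
    rw [Summable.tsum_finsetSum]
    · refine Finset.sum_congr rfl fun l _ => ?_
      rw [← realize_apply (finite_support_partialC hb l), realize, ← tsum_mul_left]
      refine tsum_congr fun k => ?_
      rw [smul_eq_mul]
      ring
    · intro l _
      refine summable_of_hasFiniteSupport (hb.subset fun k hk h => hk ?_)
      simp [partialC, h]
  rw [← realize_apply (finite_support_advect ha hb), realize]
  have h : ∀ k, fChar k x • advect a b k i
      = ∑ m ∈ ha.toFinset, fChar k x * ∑ l, a m l * partialC l b (k - m) i := by
    intro k
    rw [advect_apply, tsum_eq_sum (s := ha.toFinset)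
      (fun m hm => by simp [show a m = 0 by simpa using hm]), smul_eq_mul, Finset.mul_sum]
  simp only [h]
  rw [Summable.tsum_finsetSum hs]
  simp only [hshift]
  rw [Finset.sum_comm]
  refine Finset.sum_congr rfl fun l _ => ?_
  rw [← Finset.sum_mul, realize_eq_sum (a := a) (S := ha.toFinset) (by simp)]
  simp

lemma supN_advect_le {a b : VC d} (ha : (Function.support a).Finite)
    (hb : (Function.support b).Finite) :
    supN (advect a b) ≤ ∑ l, supN a * supN (partialC l b) := by
  refine iSup_le fun x => enorm_pi_le fun i => ?_
  rw [realize_advect ha hb]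
  refine (enorm_sum_le _ _).trans (Finset.sum_le_sum fun l _ => ?_)
  rw [enorm_mul]
  exact mul_le_mul' ((enorm_apply_le _ l).trans (enorm_realize_le_supN a x))
    ((enorm_apply_le _ i).trans (enorm_realize_le_supN _ x))

lemma tsum_enorm_advect_summand_le {a b : VC d} (ha : (Function.support a).Finite)
    (hb : (Function.support b).Finite) (k : Fin d → ℤ) (i : Fin d) :
    ∑' m, ‖∑ l, a m l * partialC l b (k - m) i‖ₑ ≤ ∑ l, supN a * supN (partialC l b) := by
  refine (ENNReal.tsum_le_tsum fun m => enorm_sum_le _ _).trans ?_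
  rw [Summable.tsum_finsetSum fun _ _ => ENNReal.summable]
  refine Finset.sum_le_sum fun l _ => ?_
  have hpb := finite_support_partialC hb l
  exact (tsum_enorm_conv_le (finite_support_apply ha l) (finite_support_apply hpb i) k).trans
    (mul_le_mul' (supN_apply_le ha l) (supN_apply_le hpb i))

/-- The Littlewood–Paley decomposition of both factors of the advection term. -/
lemma hasSum_advect_blockC (c : Cutoff) {u v : VC d}
    (h : ∑' z : ℕ × ℕ, ∑ l, supN (blockC c z.1 u) * supN (partialC l (blockC c z.2 v)) ≠ ∞)
    (k : Fin d → ℤ) (i : Fin d) :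
    HasSum (fun z : ℕ × ℕ => advect (blockC c z.1 u) (blockC c z.2 v) k i) (advect u v k i) := by
  let F : ℕ × ℕ → (Fin d → ℤ) → ℂ := fun z m =>
    ∑ l, blockC c z.1 u m l * partialC l (blockC c z.2 v) (k - m) i
  have hF : Summable (Function.uncurry F) := by
    refine Summable.of_norm (tsum_enorm_ne_top_iff_summable_norm.1 ?_)
    rw [ENNReal.tsum_prod']
    refine ne_top_of_le_ne_top h (ENNReal.tsum_le_tsum fun z => ?_)
    exact tsum_enorm_advect_summand_le (finite_support_blockC c z.1 u)
      (finite_support_blockC c z.2 v) k i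
  have hfac : ∀ z m, F z m = ((lpSymb c z.1 (znorm m) * lpSymb c z.2 (znorm (k - m)) : ℝ) : ℂ)
      * ∑ l, u m l * partialC l v (k - m) i := by
    intro z m
    simp only [F, Finset.mul_sum]
    refine Finset.sum_congr rfl fun l _ => ?_
    simp only [blockC, partialC, Pi.smul_apply, smul_eq_mul]
    push_cast
    ring
  have hone : ∀ m, ∑' z, F z m = ∑ l, u m l * partialC l v (k - m) i := by
    intro m
    have h1 := hasSum_lpSymb c (znorm_nonneg m)
    have h2 := hasSum_lpSymb c (znorm_nonneg (k - m))
    simp only [hfac]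
    rw [tsum_mul_right, ← Complex.ofReal_tsum,
      ← tsum_mul_tsum_of_summable_norm h1.summable.norm h2.summable.norm, h1.tsum_eq, h2.tsum_eq,
      mul_one, Complex.ofReal_one, one_mul]
  have hsum : Summable fun z : ℕ × ℕ => advect (blockC c z.1 u) (blockC c z.2 v) k i := by
    simp only [advect_apply]
    exact hF.prod
  rw [hsum.hasSum_iff]
  simp only [advect_apply]
  exact (Summable.tsum_comm (f := F) hF).symm.trans (tsum_congr hone)

lemma blockC_advect_blockC_eq_zero (c : Cutoff) (u v : VC d) {j p q : ℕ}
    (hj : max p q + 3 ≤ j) :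
    blockC c j (advect (blockC c p u) (blockC c q v)) = 0 := by
  ext1 k
  by_cases hk : advect (blockC c p u) (blockC c q v) k = 0
  · simp [blockC, hk]
  obtain ⟨m, hm, hkm⟩ := exists_ne_zero_of_advect_ne_zero hk
  have hm' := not_le.1 fun h => hm (blockC_eq_zero_of_le c u h)
  have hkm' := not_le.1 fun h => hkm (blockC_eq_zero_of_le c v h)
  obtain ⟨n, rfl⟩ : ∃ n, j = n + 1 := ⟨j - 1, by omega⟩
  have hp : (2 : ℝ) ^ p ≤ 2 ^ max p q := pow_le_pow_right₀ one_le_two (le_max_left _ _)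
  have hq : (2 : ℝ) ^ q ≤ 2 ^ max p q := pow_le_pow_right₀ one_le_two (le_max_right _ _)
  have hn : (2 : ℝ) ^ (max p q + 2) ≤ 2 ^ n := pow_le_pow_right₀ one_le_two (by omega)
  have hz := znorm_add_le m (k - m)
  rw [add_sub_cancel] at hz
  rw [pow_add] at hn
  rw [blockC, lpSymb_succ_eq_zero_of_le c (znorm_nonneg k) (by linarith), Complex.ofReal_zero,
    zero_smul, Pi.zero_apply]

lemma supN_blockC_advect_le_tsum (c : Cutoff) (j : ℕ) {u v : VC d}
    (h : ∑' z : ℕ × ℕ, ∑ l, supN (blockC c z.1 u) * supN (partialC l (blockC c z.2 v)) ≠ ∞) :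
    supN (blockC c j (advect u v)) ≤
      ∑' z : ℕ × ℕ, supN (blockC c j (advect (blockC c z.1 u) (blockC c z.2 v))) := by
  refine iSup_le fun x => ?_
  let S : Finset (Fin d → ℤ) := (finite_znorm_lt (2 ^ j)).toFinset
  have hS : ∀ w : VC d, realize (blockC c j w) x = ∑ k ∈ S, fChar k x • blockC c j w k :=
    fun w => realize_eq_sum (fun k hk => blockC_eq_zero_of_le c w (by simpa [S] using hk)) x
  have hsum : HasSum (fun z : ℕ × ℕ =>
      realize (blockC c j (advect (blockC c z.1 u) (blockC c z.2 v))) x)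
      (realize (blockC c j (advect u v)) x) := by
    simp only [hS]
    refine hasSum_sum fun k _ => ?_
    exact ((Pi.hasSum.2 fun i => hasSum_advect_blockC c h k i).const_smul _).const_smul _
  rw [← hsum.tsum_eq]
  exact enorm_tsum_le_tsum_enorm.trans (ENNReal.tsum_le_tsum fun z => enorm_realize_le_supN _ x)

lemma besov_top_one_eq [NormedAddCommGroup E] [NormedSpace ℂ E] (c : Cutoff) (s : ℕ)
    (a : (Fin d → ℤ) → E) :
    besov c s ∞ 1 a = ∑' j : ℕ, 2 ^ (j * s) * supN (blockC c j a) := by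
  simp only [besov, lr, ENNReal.one_ne_top, if_false, ENNReal.toReal_one, ENNReal.rpow_one,
    div_one, tLp_top_eq_supN (finite_support_blockC c _ a)]
  refine tsum_congr fun j => ?_
  rw [← Nat.cast_mul, ENNReal.rpow_natCast]

lemma tsum_geometric_truncated_le (M : ℕ) (y : ℝ≥0∞) :
    ∑' j : ℕ, (2 : ℝ≥0∞) ^ j * (if j < M then y else 0) ≤ 2 ^ M * y := by
  rw [tsum_eq_sum (s := Finset.range M) (fun j hj => by simp_all)]
  have h : ∑ j ∈ Finset.range M, (2 : ℝ≥0∞) ^ j ≤ 2 ^ M := by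
    have := Nat.geomSum_eq (le_refl 2) M
    have h' : ∑ j ∈ Finset.range M, 2 ^ j ≤ 2 ^ M := by
      rw [this]
      simp
    exact_mod_cast h'
  refine le_trans (le_of_eq ?_) (mul_le_mul_left h y)
  rw [Finset.sum_mul]
  exact Finset.sum_congr rfl fun j hj => by rw [if_pos (Finset.mem_range.1 hj)]

/-- Splitting a double dyadic sum according to which index is the larger one. -/
lemma tsum_max_le (A B : ℕ → ℝ≥0∞) :
    ∑' z : ℕ × ℕ, 2 ^ max z.1 z.2 * (2 ^ z.2 * (A z.1 * B z.2)) ≤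
      (∑' p, A p) * (∑' q, 2 ^ (q * 2) * B q) + (∑' p, 2 ^ p * A p) * ∑' q, 2 ^ q * B q := by
  have hmul : ∀ f g : ℕ → ℝ≥0∞, (∑' p, f p) * (∑' q, g q) = ∑' z : ℕ × ℕ, f z.1 * g z.2 := by
    intro f g
    rw [ENNReal.tsum_prod', ← ENNReal.tsum_mul_right]
    simp only [ENNReal.tsum_mul_left]
  rw [hmul, hmul, ← ENNReal.tsum_add]
  refine ENNReal.tsum_le_tsum fun z => ?_
  rcases le_total z.1 z.2 with h | h
  · rw [max_eq_right h]
    refine le_trans (le_of_eq ?_) le_self_add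
    ring
  · rw [max_eq_left h]
    refine le_trans (le_of_eq ?_) le_add_self
    ring

end Advection

/-- **Product rule in `B^1_{∞,1}` with div-curl structure.**  There is a constant
`C > 0` such that for vector fields `u, v` on `𝕋^d` with `div u = 0`,
`‖u·∇v‖_{B^1_{∞,1}} ≤ C(‖u‖_{B^0_{∞,1}}‖v‖_{B^2_{∞,1}} + ‖u‖_{B^1_{∞,1}}‖v‖_{B^1_{∞,1}})`. -/
theorem product_rule_B11 (d : ℕ) (c : Cutoff) :
    ∃ C : ℝ≥0, 0 < C ∧
      ∀ u v : VC d, DivFree u →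
        besov c 1 ∞ 1 (advect u v) ≤
          (C : ℝ≥0∞) * (besov c 0 ∞ 1 u * besov c 2 ∞ 1 v
            + besov c 1 ∞ 1 u * besov c 1 ∞ 1 v) := by
  obtain ⟨C₁, hC₁⟩ := exists_supN_blockC_le (d := d) (E := Fin d → ℂ) c
  obtain ⟨C₂, hC₂⟩ := exists_supN_partialC_blockC_le (d := d) (E := Fin d → ℂ) c
  -- one is added so that the constant is positive
  let K : ℝ≥0 := (C₁ + 1) * (d * C₂ + 1)
  refine ⟨8 * K, by positivity, fun u v _ => ?_⟩
  let A : ℕ → ℝ≥0∞ := fun p => supN (blockC c p u)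
  let B : ℕ → ℝ≥0∞ := fun q => supN (blockC c q v)
  let X : ℝ≥0∞ := ∑' z : ℕ × ℕ, 2 ^ max z.1 z.2 * (2 ^ z.2 * (A z.1 * B z.2))
  have hX : X ≤ besov c 0 ∞ 1 u * besov c 2 ∞ 1 v + besov c 1 ∞ 1 u * besov c 1 ∞ 1 v := by
    have h0 := besov_top_one_eq c 0 u
    have h1 := besov_top_one_eq c 1 u
    have h1' := besov_top_one_eq c 1 v
    have h2 := besov_top_one_eq c 2 v
    simp only [Nat.cast_zero, Nat.cast_one, Nat.cast_ofNat, mul_zero, mul_one, pow_zero,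
      one_mul] at h0 h1 h1' h2
    rw [h0, h1, h1', h2]
    exact tsum_max_le A B
  have hK0 : (8 * K : ℝ≥0) ≠ 0 := by positivity
  rcases eq_or_ne X ∞ with hXtop | hXtop
  · rw [hXtop, top_le_iff] at hX
    rw [hX, ENNReal.mul_top (by exact_mod_cast hK0)]
    exact le_top
  have hsum : ∀ p q, ∑ l, A p * supN (partialC l (blockC c q v))
      ≤ ((d * C₂ + 1 : ℝ≥0) : ℝ≥0∞) * (2 ^ q * (A p * B q)) := by
    intro p q
    refine (Finset.sum_le_sum fun l _ => mul_le_mul_right (hC₂ l q v) (A p)).trans ?_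
    rw [Finset.sum_const, Finset.card_univ, Fintype.card_fin, nsmul_eq_mul]
    calc (d : ℝ≥0∞) * (A p * (C₂ * 2 ^ q * B q)) = d * C₂ * (2 ^ q * (A p * B q)) := by ring
      _ ≤ _ := by
        push_cast
        gcongr
        exact le_self_add
  have hfin : ∑' z : ℕ × ℕ, ∑ l, A z.1 * supN (partialC l (blockC c z.2 v)) ≠ ∞ := by
    have hne : ((d * C₂ + 1 : ℝ≥0) : ℝ≥0∞) * X ≠ ∞ := ENNReal.mul_ne_top ENNReal.coe_ne_top hXtop
    refine ne_top_of_le_ne_top hne ?_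
    rw [← ENNReal.tsum_mul_left]
    refine ENNReal.tsum_le_tsum fun z => (hsum z.1 z.2).trans ?_
    refine mul_le_mul_right ?_ _
    exact le_mul_of_one_le_left zero_le (one_le_pow₀ (one_le_two (α := ℝ≥0∞)))
  have hblock : ∀ (j : ℕ) (z : ℕ × ℕ),
      supN (blockC c j (advect (blockC c z.1 u) (blockC c z.2 v)))
        ≤ if j < max z.1 z.2 + 3 then K * (2 ^ z.2 * (A z.1 * B z.2)) else 0 := by
    intro j z
    have hu := finite_support_blockC c z.1 u
    have hv := finite_support_blockC c z.2 v
    split_ifs with hj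
    · calc _ ≤ _ := hC₁ j _ (finite_support_advect hu hv)
        _ ≤ C₁ * (((d * C₂ + 1 : ℝ≥0) : ℝ≥0∞) * (2 ^ z.2 * (A z.1 * B z.2))) := by
          gcongr
          exact (supN_advect_le hu hv).trans (hsum z.1 z.2)
        _ ≤ _ := by
          rw [← mul_assoc, ← ENNReal.coe_mul]
          gcongr
          exact mul_le_mul' le_self_add le_rfl
    · rw [blockC_advect_blockC_eq_zero c u v (not_lt.1 hj)]
      simp [supN, realize]
  have hadv := besov_top_one_eq c 1 (advect u v)
  simp only [Nat.cast_one, mul_one] at hadv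
  rw [hadv]
  calc ∑' j : ℕ, 2 ^ j * supN (blockC c j (advect u v))
      ≤ ∑' j : ℕ, ∑' z : ℕ × ℕ, 2 ^ j *
          (if j < max z.1 z.2 + 3 then K * (2 ^ z.2 * (A z.1 * B z.2)) else 0) := by
        refine ENNReal.tsum_le_tsum fun j => ?_
        rw [ENNReal.tsum_mul_left]
        gcongr
        exact (supN_blockC_advect_le_tsum c j hfin).trans (ENNReal.tsum_le_tsum (hblock j))
    _ ≤ ∑' z : ℕ × ℕ, 2 ^ (max z.1 z.2 + 3) * (K * (2 ^ z.2 * (A z.1 * B z.2))) := by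
        rw [ENNReal.tsum_comm]
        exact ENNReal.tsum_le_tsum fun z => tsum_geometric_truncated_le _ _
    _ = ((8 * K : ℝ≥0) : ℝ≥0∞) * X := by
        rw [← ENNReal.tsum_mul_left]
        refine tsum_congr fun z => ?_
        rw [pow_add]
        push_cast
        ring
    _ ≤ _ := by gcongr
end
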